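/- Let q = 2^m, m odd, m ≥ 15 + 2s, G(x) = a_7 x^7 + ∑_{i=1}^s b_i x^(2^i+1) with a_7 ≠ 0, f = Tr ∘ G. Then ‖f̂‖_∞ > √(2q); that is, f is not almost optimal: its nonlinearity is strictly below 2^(m−1) − 2^((m−1)/2). -/

import Mathlib

open Finset
open scoped Classical

/-- Walsh transform of `f` on `F_{2^m}` with pairing `Tr(vx)`. -/
noncomputable def walshF (m : ℕ) [Fintype (GaloisField 2 m)]
    (f : GaloisField 2 m → ZMod 2) (v : GaloisField 2 m) : ℤ :=
  ∑ x : GaloisField 2 m,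
    (-1 : ℤ) ^ (f x + Algebra.trace (ZMod 2) (GaloisField 2 m) (v * x)).val

/-- Nonlinearity: minimal Hamming distance to an affine function. -/
noncomputable def nlF (m : ℕ) [Fintype (GaloisField 2 m)]
    (f : GaloisField 2 m → ZMod 2) : ℕ :=
  sInf { n | ∃ (v : GaloisField 2 m) (c : ZMod 2),
    n = (Finset.univ.filter fun x =>
      f x ≠ Algebra.trace (ZMod 2) (GaloisField 2 m) (v * x) + c).card }

section Sign

variable {F : Type*} [Field F] [Algebra (ZMod 2) F]

/-- The canonical additive character `x ↦ (-1) ^ Tr x` of a finite field of characteristic two. -/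
noncomputable def sgn (x : F) : ℤ :=
  (-1) ^ (Algebra.trace (ZMod 2) F x).val

theorem neg_one_pow_val_add (a b : ZMod 2) :
    (-1 : ℤ) ^ (a + b).val = (-1) ^ a.val * (-1) ^ b.val := by
  revert a b; decide

theorem sgn_add (x y : F) : sgn (x + y) = sgn x * sgn y := by
  simp only [sgn, map_add, neg_one_pow_val_add]

theorem sgn_zero : sgn (0 : F) = 1 := by simp [sgn]

theorem sgn_eq_one_or (x : F) : sgn x = 1 ∨ sgn x = -1 := neg_one_pow_eq_or ℤ _

theorem sgn_eq_one_iff (x : F) : sgn x = 1 ↔ Algebra.trace (ZMod 2) F x = 0 := by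
  have h : ∀ a : ZMod 2, (-1 : ℤ) ^ a.val = 1 ↔ a = 0 := by decide
  exact h _

theorem charP_two (F : Type*) [Field F] [Algebra (ZMod 2) F] : CharP F 2 :=
  charP_of_injective_algebraMap (algebraMap (ZMod 2) F).injective 2

theorem sgn_sum {ι : Type*} (s : Finset ι) (g : ι → F) :
    sgn (∑ i ∈ s, g i) = ∏ i ∈ s, sgn (g i) := by
  induction s using Finset.induction_on with
  | empty => simp [sgn_zero]
  | insert a s ha ih => rw [Finset.sum_insert ha, Finset.prod_insert ha, sgn_add, ih]

variable [Fintype F]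

theorem trace_sq (x : F) :
    Algebra.trace (ZMod 2) F (x ^ 2) = Algebra.trace (ZMod 2) F x := by
  have h := Algebra.trace_eq_of_algEquiv
    (FiniteField.frobeniusAlgEquivOfAlgebraic (ZMod 2) F) x
  simpa using h

theorem sgn_sq (x : F) : sgn (x ^ 2) = sgn x := by rw [sgn, trace_sq, sgn]

theorem sgn_pow_two_pow (x : F) (n : ℕ) : sgn (x ^ 2 ^ n) = sgn x := by
  induction n with
  | zero => simp
  | succ n ih => rw [pow_succ, pow_mul, sgn_sq, ih]

theorem exists_sgn_mul_eq {u : F} (hu : u ≠ 0) : ∃ y : F, sgn (u * y) = -1 := by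
  have htr := (traceForm_nondegenerate (ZMod 2) F).1 u
  simp_rw [Algebra.traceForm_apply] at htr
  by_contra! hf
  refine hu (htr fun y => ?_)
  exact (sgn_eq_one_iff _).1 ((sgn_eq_one_or _).resolve_right (hf y))

theorem sum_sgn_mul (u : F) :
    ∑ x : F, sgn (u * x) = if u = 0 then (Fintype.card F : ℤ) else 0 := by
  split_ifs with hu
  · simp [hu, sgn_zero]
  · obtain ⟨y, hy⟩ := exists_sgn_mul_eq hu
    have h : ∑ x : F, sgn (u * x) = ∑ x : F, sgn (u * (x + y)) :=
      (Equiv.sum_comp (Equiv.addRight y) fun x => sgn (u * x)).symm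
    simp only [mul_add, sgn_add, hy, mul_neg_one, Finset.sum_neg_distrib] at h
    linarith

theorem bijective_pow_two_pow (n : ℕ) : Function.Bijective fun x : F => x ^ 2 ^ n := by
  have := charP_two F
  have h := (iterateFrobenius F 2 n).injective
  exact Finite.injective_iff_bijective.1 fun x y hxy => h (by simpa [iterateFrobenius_def] using hxy)

theorem card_artinSchreier (x : F) :
    (((univ : Finset F).filter fun y => y ^ 2 + y = x).card : ℤ) = 1 + sgn x := by
  have := charP_two F
  have hq : (Fintype.card F : ℤ) ≠ 0 := by exact_mod_cast Fintype.card_ne_zero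
  apply mul_left_cancel₀ hq
  have h1 : (Fintype.card F : ℤ) * ((univ : Finset F).filter fun y => y ^ 2 + y = x).card =
      ∑ y : F, ∑ u : F, sgn ((y ^ 2 + y + x) * u) := by
    simp_rw [sum_sgn_mul, CharTwo.add_eq_zero]
    rw [← Finset.sum_filter, Finset.sum_const]
    simp [mul_comm]
  have h2 : ∀ u : F, ∑ y : F, sgn ((y ^ 2 + y + x) * u) =
      sgn (x * u) * if u = 0 ∨ u = 1 then (Fintype.card F : ℤ) else 0 := by
    intro u
    have h3 : ∀ y : F, sgn ((y ^ 2 + y + x) * u) = sgn (x * u) * sgn ((u + u ^ 2) * y ^ 2) := by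
      intro y
      rw [add_mul, add_mul, sgn_add, sgn_add, ← sgn_sq (y * u), add_mul, sgn_add,
        mul_comm (y ^ 2) u, mul_pow, mul_comm (y ^ 2) (u ^ 2)]
      ring
    simp_rw [h3]
    rw [← Finset.mul_sum]
    have h4 := (bijective_pow_two_pow (F := F) 1).sum_comp fun z => sgn ((u + u ^ 2) * z)
    simp only [pow_one] at h4
    rw [h4, sum_sgn_mul]
    have : u + u ^ 2 = 0 ↔ u = 0 ∨ u = 1 := by
      rw [show u + u ^ 2 = u * (u - 1) by rw [CharTwo.sub_eq_add]; ring, mul_eq_zero, sub_eq_zero]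
    simp only [this]
  rw [h1, Finset.sum_comm]
  simp_rw [h2]
  simp only [mul_ite, mul_zero]
  rw [← Finset.sum_filter, show (univ.filter fun u : F => u = 0 ∨ u = 1) = {0, 1} by ext; simp,
    Finset.sum_pair zero_ne_one]
  simp [sgn_zero]
  ring

theorem finrank_of_card {m : ℕ} (hF : Fintype.card F = 2 ^ m) :
    Module.finrank (ZMod 2) F = m := by
  have h := Module.card_eq_pow_finrank (K := ZMod 2) (V := F)
  rw [hF, ZMod.card] at h
  exact (Nat.pow_right_injective le_rfl h).symm

theorem sgn_one {m : ℕ} (hF : Fintype.card F = 2 ^ m) (hm : Odd m) : sgn (1 : F) = -1 := by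
  have h : Algebra.trace (ZMod 2) F (1 : F) = 1 := by
    have := Algebra.trace_algebraMap (S := F) (1 : ZMod 2)
    rw [map_one, finrank_of_card hF] at this
    rw [this, nsmul_one, ZMod.natCast_eq_one_iff_odd]
    exact hm
  rw [sgn, h]
  rfl

theorem sum_pow_eq_zero_of_sgn {m : ℕ} (hF : Fintype.card F = 2 ^ m) {x : F} (hx : sgn x = 1) :
    ∑ i ∈ range m, x ^ 2 ^ i = 0 := by
  have h := FiniteField.algebraMap_trace_eq_sum_pow (ZMod 2) F x
  rw [(sgn_eq_one_iff x).1 hx, finrank_of_card hF, map_zero, Nat.card_zmod] at h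
  exact h.symm

end Sign

theorem bijective_pow_three {F : Type*} [Field F] [Fintype F] {m : ℕ}
    (hF : Fintype.card F = 2 ^ m) (hm : Odd m) :
    Function.Bijective fun x : F => x ^ 3 := by
  refine Finite.injective_iff_bijective.1 fun x y hxy => ?_
  obtain ⟨k, rfl⟩ := hm
  have h3 : ∃ n, 2 * 2 ^ (2 * k + 1) = 3 * n + 1 := by
    have : (2 * 2 ^ (2 * k + 1)) % 3 = 1 := by
      rw [pow_succ, pow_mul, show 2 * ((2 ^ 2) ^ k * 2) = 4 ^ k * 4 by norm_num; ring,
        Nat.mul_mod, Nat.pow_mod]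
      norm_num
    exact ⟨2 * 2 ^ (2 * k + 1) / 3, by omega⟩
  obtain ⟨n, hn⟩ := h3
  have key : ∀ z : F, (z ^ 3) ^ n * z = z ^ 2 := by
    intro z
    rw [← pow_mul, ← pow_succ, ← hn, mul_comm 2, pow_mul, ← hF, FiniteField.pow_card]
  have hxy' : x ^ 3 = y ^ 3 := hxy
  by_cases hx : x = 0
  · subst hx
    exact (by simpa using hxy'.symm : y = 0).symm
  have hy : y ≠ 0 := by
    rintro rfl
    exact hx (by simpa using hxy')
  have hx' := key x
  have hy' := key y
  rw [pow_two] at hx' hy'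
  rw [← mul_right_cancel₀ hx hx', ← mul_right_cancel₀ hy hy', hxy']

section Stepanov

open Polynomial

theorem exists_nontrivial_relation_of_natDegree_lt {F ι : Type*} [Field F] [Fintype ι]
    (n : ℕ) (h : ι → F[X]) (hdeg : ∀ i, (h i).natDegree < n) (hn : n < Fintype.card ι) :
    ∃ c : ι → F, ∑ i, c i • h i = 0 ∧ ∃ i, c i ≠ 0 := by
  have hmem : ∀ i, h i ∈ degreeLT F n := fun i =>
    mem_degreeLT.2 (degree_le_natDegree.trans_lt (by exact_mod_cast hdeg i))
  have hli : ¬ LinearIndependent F fun i => (⟨h i, hmem i⟩ : degreeLT F n) := by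
    intro hli
    have := Module.Finite.equiv (degreeLTEquiv F n).symm
    have h1 := hli.fintype_card_le_finrank
    rw [(degreeLTEquiv F n).finrank_eq, Module.finrank_fin_fun] at h1
    omega
  obtain ⟨c, hc, hi⟩ := Fintype.not_linearIndependent_iff.1 hli
  exact ⟨c, by simpa using congrArg Subtype.val hc, hi⟩

/-- The polynomial `X ^ (e * 2 ^ k) * ∑ i ≤ k, (p / X ^ e) ^ 2 ^ i`. -/
noncomputable def partialTrace {F : Type*} [Field F] (p : F[X]) (e k : ℕ) : F[X] :=
  ∑ i ∈ Finset.range (k + 1), p ^ 2 ^ i * X ^ (e * (2 ^ k - 2 ^ i))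

theorem eval_partialTrace {F : Type*} [Field F] (p : F[X]) (e k : ℕ) {x : F} (hx : x ≠ 0) :
    (partialTrace p e k).eval x =
      x ^ (e * 2 ^ k) * ∑ i ∈ Finset.range (k + 1), (p.eval x / x ^ e) ^ 2 ^ i := by
  simp only [partialTrace, eval_finsetSum, eval_mul, eval_pow, eval_X, Finset.mul_sum]
  refine Finset.sum_congr rfl fun i hi => ?_
  have h : 2 ^ i ≤ 2 ^ k := Nat.pow_le_pow_right two_pos (by simpa [Nat.lt_succ_iff] using hi)
  obtain ⟨t, ht⟩ := Nat.exists_eq_add_of_le h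
  rw [ht, Nat.add_sub_cancel_left, div_pow, ← pow_mul, mul_add, pow_add]
  field_simp

theorem natDegree_partialTrace {F : Type*} [Field F] {p : F[X]} {e d : ℕ}
    (hp : p.natDegree = d + e) (hd : 0 < d) (k : ℕ) :
    (partialTrace p e k).natDegree = (d + e) * 2 ^ k := by
  have hlast : (p ^ 2 ^ k * X ^ (e * (2 ^ k - 2 ^ k)) : F[X]).natDegree = (d + e) * 2 ^ k := by
    simp [natDegree_pow, hp, mul_comm]
  have hpos : 0 < (d + e) * 2 ^ k := by positivity
  rw [partialTrace, Finset.sum_range_succ, natDegree_add_eq_right_of_natDegree_lt, hlast]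
  rw [hlast]
  refine lt_of_le_of_lt (natDegree_sum_le_of_forall_le (n := (d + e) * 2 ^ k - 1) _ _ ?_)
    (by omega)
  intro i hi
  refine natDegree_mul_le.trans ?_
  rw [natDegree_pow, natDegree_X_pow, hp]
  have h : 2 ^ i < 2 ^ k := Nat.pow_lt_pow_right one_lt_two (by simpa using hi)
  obtain ⟨t, ht⟩ := Nat.exists_eq_add_of_lt h
  have h2 : 2 ^ k - 2 ^ i = t + 1 := by omega
  rw [h2, ht]
  have : 0 < d * (t + 1) := by positivity
  have h3 : (d + e) * (2 ^ i + t + 1) = 2 ^ i * (d + e) + e * (t + 1) + d * (t + 1) := by ring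
  omega

theorem sum_smul_ne_zero_of_natDegree_injective {F ι : Type*} [Field F] [Fintype ι]
    (g : ι → F[X]) (hg : ∀ i, g i ≠ 0) (hinj : Function.Injective fun i => (g i).natDegree)
    (c : ι → F) (hc : ∃ i, c i ≠ 0) : ∑ i, c i • g i ≠ 0 := by
  obtain ⟨i₀, hi₀⟩ := hc
  have hdeg : ∀ i, c i ≠ 0 → (c i • g i).degree = (g i).natDegree := fun i hi => by
    rw [smul_eq_C_mul, degree_C_mul hi, degree_eq_natDegree (hg i)]
  intro h0
  have h := degree_sum_eq_of_disjoint (fun i => c i • g i) univ ?_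
  · rw [h0, degree_zero] at h
    have h1 := Finset.le_sup (f := fun i => (c i • g i).degree) (Finset.mem_univ i₀)
    rw [← h, hdeg i₀ hi₀] at h1
    simp at h1
  · rintro i ⟨-, hi⟩ j ⟨-, hj⟩ hij heq
    have hi' : c i ≠ 0 := fun h => hi (by simp [h])
    have hj' : c j ≠ 0 := fun h => hj (by simp [h])
    simp only [Function.comp, hdeg i hi', hdeg j hj'] at heq
    exact hij (hinj (by exact_mod_cast heq))

theorem card_filter_sgn_eq_one_le {F : Type*} [Field F] [Fintype F] [Algebra (ZMod 2) F] {l : ℕ}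
    (hF : Fintype.card F = 2 ^ (2 * l + 3)) (p : F[X]) {d e μ : ℕ} (hp : p.natDegree = d + e)
    (hd : Odd d) (hμ : 0 < μ)
    (hdim : μ + 2 ^ (l + 1) * (2 ^ (l + 1) - 1) + (d + e) * 2 ^ l < 2 * μ * 2 ^ (l + 1)) :
    ((univ : Finset F).filter fun x => x ≠ 0 ∧ sgn (p.eval x / x ^ e) = 1).card +
      2 ^ (l + 1) + 1 ≤ (2 * μ + (d + e)) * 2 ^ (l + 1) := by
  have hchar := charP_two F
  set r : ℕ := 2 ^ (l + 1) with hr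
  have hr0 : 0 < r := by positivity
  have hT := fun k => natDegree_partialTrace hp hd.pos k
  have hT0 : ∀ k, partialTrace p e k ≠ 0 := fun k h0 => by
    have h1 := hT k
    have h2 : 0 < (d + e) * 2 ^ k := Nat.mul_pos (by have := hd.pos; omega) (by positivity)
    rw [h0, natDegree_zero] at h1
    omega
  let w : ℕ → Bool → F[X] := fun k b => if b then partialTrace p e k else X ^ (e * 2 ^ k)
  have hw0 : ∀ k b, w k b ≠ 0 := fun k b => by
    cases b
    · simp [w]
    · simpa [w] using hT0 k
  have hwdeg : ∀ k b, (w k b).natDegree = (if b then d + e else e) * 2 ^ k := fun k b => by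
    cases b
    · simp [w]
    · simpa [w] using hT k
  have hwle : ∀ k b, (w k b).natDegree ≤ (d + e) * 2 ^ k := fun k b => by
    rw [hwdeg]
    exact Nat.mul_le_mul_right _ (by split_ifs <;> omega)
  let g : Fin μ × Bool × Fin r → F[X] := fun t => X ^ (t.1.1 * (2 * r) + t.2.2.1) * w (l + 1) t.2.1
  let h : Fin μ × Bool × Fin r → F[X] := fun t => X ^ (t.1.1 + r * t.2.2.1) * w l t.2.1
  have hgdeg : ∀ t, (g t).natDegree =
      t.1.1 * (2 * r) + t.2.2.1 + (if t.2.1 then d + e else e) * r := fun t => by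
    simp only [g]
    rw [natDegree_mul (pow_ne_zero _ X_ne_zero) (hw0 _ _), natDegree_X_pow, hwdeg]
  obtain ⟨c, hc, hc0⟩ := exists_nontrivial_relation_of_natDegree_lt
    (μ + r * (r - 1) + (d + e) * 2 ^ l) h (fun t => by
      refine lt_of_le_of_lt natDegree_mul_le ?_
      rw [natDegree_X_pow]
      have h1 := hwle l t.2.1
      have h2 : r * t.2.2.1 ≤ r * (r - 1) :=
        Nat.mul_le_mul_left _ (by have := t.2.2.2; omega)
      have h3 := t.1.2
      omega)
    (by simpa [mul_comm, mul_left_comm, mul_assoc] using hdim)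
  choose b hb using fun t => (bijective_pow_two_pow (F := F) (l + 1)).2 (c t)
  have hb0 : ∃ t, b t ≠ 0 := by
    obtain ⟨t, ht⟩ := hc0
    refine ⟨t, fun h0 => ht ?_⟩
    rw [← hb t, h0]
    simp
  have hG := sum_smul_ne_zero_of_natDegree_injective g
    (fun t => mul_ne_zero (pow_ne_zero _ X_ne_zero) (hw0 _ _)) ?_ b hb0
  · set G := ∑ t, b t • g t with hGdef
    have hGdeg : G.natDegree ≤ (μ - 1) * (2 * r) + (r - 1) + (d + e) * r := by
      refine natDegree_sum_le_of_forall_le _ _ fun t _ => (natDegree_smul_le _ _).trans ?_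
      rw [hgdeg]
      have h1 : t.1.1 * (2 * r) ≤ (μ - 1) * (2 * r) :=
        Nat.mul_le_mul_right _ (by have := t.1.2; omega)
      have h2 := t.2.2.2
      have h3 : (if t.2.1 then d + e else e) * r ≤ (d + e) * r :=
        Nat.mul_le_mul_right _ (by split_ifs <;> omega)
      omega
    have hroots : ((univ : Finset F).filter fun x => x ≠ 0 ∧ sgn (p.eval x / x ^ e) = 1).card ≤
        G.natDegree := by
      refine card_le_degree_of_subset_roots fun x hx => ?_
      obtain ⟨hx0, hx1⟩ : x ≠ 0 ∧ sgn (p.eval x / x ^ e) = 1 := by simpa using hx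
      rw [mem_roots hG, IsRoot]
      set z := p.eval x / x ^ e with hz
      have htr := sum_pow_eq_zero_of_sgn hF hx1
      have hxq : x ^ (2 * r * r) = x := by
        have := FiniteField.pow_card x
        rwa [hF, show 2 ^ (2 * l + 3) = 2 * r * r by rw [hr]; ring] at this
      have hw : ∀ b, ((w (l + 1) b).eval x / x ^ (e * r)) ^ r =
          (w l b).eval x / x ^ (e * 2 ^ l) := by
        have hpow : ∀ n, x ^ n ≠ 0 := fun n => pow_ne_zero n hx0
        intro b
        cases b
        · simp [w, hr, hx0]
        · simp only [w, if_true]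
          rw [eval_partialTrace _ _ _ hx0, eval_partialTrace _ _ _ hx0, ← hr,
            mul_div_cancel_left₀ _ (hpow _), mul_div_cancel_left₀ _ (hpow _), ← hz, hr,
            sum_pow_char_pow]
          rw [show 2 * l + 3 = (l + 1) + (l + 2) by ring, Finset.sum_range_add,
            CharTwo.add_eq_zero] at htr
          rw [htr]
          refine Finset.sum_congr rfl fun i _ => ?_
          rw [← pow_mul, ← pow_add, add_comm i]
      have hgh : ∀ t, ((g t).eval x / x ^ (e * r)) ^ r = (h t).eval x / x ^ (e * 2 ^ l) := by
        intro t
        simp only [g, h, eval_mul, eval_pow, eval_X]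
        rw [mul_div_assoc, mul_pow, hw, mul_div_assoc]
        congr 1
        rw [← pow_mul, add_mul, pow_add, pow_add, mul_assoc (t.1.1), mul_comm (t.1.1), pow_mul, hxq,
          mul_comm r]
      have hz : (G.eval x / x ^ (e * r)) ^ r = 0 := by
        have hfrob : ∀ v : Fin μ × Bool × Fin r → F, (∑ t, v t) ^ r = ∑ t, v t ^ r := fun v =>
          sum_pow_char_pow 2 (l + 1) _ _
        rw [hGdef, eval_finsetSum, Finset.sum_div, hfrob]
        have hterm : ∀ t, ((b t • g t).eval x / x ^ (e * r)) ^ r =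
            (c t • h t).eval x / x ^ (e * 2 ^ l) := by
          intro t
          rw [eval_smul, eval_smul, smul_eq_mul, smul_eq_mul, mul_div_assoc, mul_pow, hgh,
            mul_div_assoc]
          congr 1
          exact hb t
        simp_rw [hterm]
        rw [← Finset.sum_div, ← eval_finsetSum, hc, eval_zero, zero_div]
      have := eq_zero_of_pow_eq_zero hz
      exact (div_eq_zero_iff.1 this).resolve_right (pow_ne_zero _ hx0)
    obtain ⟨ν, rfl⟩ : ∃ ν, μ = ν + 1 := ⟨μ - 1, by omega⟩
    have h4 : (2 * (ν + 1) + (d + e)) * r = ν * (2 * r) + 2 * r + (d + e) * r := by ring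
    rw [Nat.add_sub_cancel] at hGdeg
    omega
  · rintro ⟨i, b, j⟩ ⟨i', b', j'⟩ hij
    simp only [hgdeg] at hij
    have key : ∀ n n' : ℕ, n * r + j = n' * r + j' → n = n' ∧ j.1 = j'.1 := by
      intro n n' hn
      have h1 := congrArg (· / r) hn
      have h2 := congrArg (· % r) hn
      simp only [mul_comm _ r, Nat.mul_add_div hr0, Nat.div_eq_of_lt j.2, Nat.div_eq_of_lt j'.2,
        Nat.mul_add_mod, Nat.mod_eq_of_lt j.2, Nat.mod_eq_of_lt j'.2, add_zero] at h1 h2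
      exact ⟨h1, h2⟩
    obtain ⟨h1, h2⟩ := key (2 * i + if b then d + e else e) (2 * i' + if b' then d + e else e)
      (by linear_combination hij)
    obtain ⟨a, rfl⟩ := hd
    have hbb : b = b' := by cases b <;> cases b' <;> simp at h1 ⊢ <;> omega
    subst hbb
    have h3 : i.1 = i'.1 := by omega
    rw [Fin.ext h3, Fin.ext h2]

end Stepanov

section Moments

variable {F : Type*} [Field F] [Fintype F] [Algebra (ZMod 2) F]

/-- The Walsh transform of `Tr ∘ g`. -/
noncomputable def walshSum (g : F → F) (v : F) : ℤ :=
  ∑ x, sgn (g x + v * x)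

theorem sum_sq_sum_sgn_mul (R : F → ℤ) :
    ∑ v : F, (∑ a : F, sgn (v * a) * R a) ^ 2 = Fintype.card F * ∑ a : F, R a ^ 2 := by
  have := charP_two F
  have h : ∀ v : F, (∑ a : F, sgn (v * a) * R a) ^ 2 =
      ∑ a : F, ∑ b : F, R a * R b * sgn ((a + b) * v) := by
    intro v
    rw [pow_two, Finset.sum_mul_sum]
    refine Finset.sum_congr rfl fun a _ => Finset.sum_congr rfl fun b _ => ?_
    rw [add_mul, sgn_add, mul_comm a, mul_comm b]
    ring
  simp_rw [h]
  rw [Finset.sum_comm, Finset.mul_sum]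
  refine Finset.sum_congr rfl fun a _ => ?_
  rw [Finset.sum_comm]
  simp_rw [← Finset.mul_sum, sum_sgn_mul, CharTwo.add_eq_zero]
  simp
  ring

theorem sum_walshSum_sq (g : F → F) :
    ∑ v, walshSum g v ^ 2 = (Fintype.card F : ℤ) ^ 2 := by
  have h := sum_sq_sum_sgn_mul fun x => sgn (g x)
  have h1 : ∀ v, walshSum g v = ∑ a : F, sgn (v * a) * sgn (g a) := fun v =>
    Finset.sum_congr rfl fun x _ => by rw [sgn_add, mul_comm]
  have h2 : ∀ x : F, sgn x ^ 2 = 1 := fun x => by rcases sgn_eq_one_or x with h | h <;> simp [h]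
  simp_rw [h1, h, h2]
  simp [pow_two]

theorem sum_walshSum_pow_four (g : F → F) :
    ∑ v, walshSum g v ^ 4 = Fintype.card F *
      ∑ a, ∑ b, ∑ x, sgn (g x + g (x + a) + g (x + b) + g (x + a + b)) := by
  have h1 : ∀ v, walshSum g v ^ 2 =
      ∑ a : F, sgn (v * a) * ∑ x, sgn (g x + g (x + a)) := by
    intro v
    have := charP_two F
    rw [pow_two, walshSum, Finset.sum_mul_sum]
    simp_rw [Finset.mul_sum]
    rw [Finset.sum_comm (s := univ) (t := univ) (f := fun a x => sgn (v * a) * sgn (g x + g (x + a)))]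
    refine Finset.sum_congr rfl fun x _ => ?_
    rw [← Equiv.sum_comp (Equiv.addLeft x)]
    refine Finset.sum_congr rfl fun a _ => ?_
    simp only [Equiv.coe_addLeft]
    rw [← sgn_add, ← sgn_add]
    congr 1
    linear_combination CharTwo.add_self_eq_zero (v * x)
  have h2 : ∀ v, walshSum g v ^ 4 = (walshSum g v ^ 2) ^ 2 := fun v => by ring
  simp_rw [h2, h1]
  rw [sum_sq_sum_sgn_mul]
  congr 1
  refine Finset.sum_congr rfl fun a _ => ?_
  rw [pow_two, Finset.sum_mul_sum, Finset.sum_comm (s := univ) (t := univ) (f := fun b x =>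
    sgn (g x + g (x + a) + g (x + b) + g (x + a + b)))]
  refine Finset.sum_congr rfl fun x _ => ?_
  rw [← Equiv.sum_comp (Equiv.addLeft x)]
  refine Finset.sum_congr rfl fun b _ => ?_
  simp only [Equiv.coe_addLeft]
  rw [← sgn_add]
  congr 1
  rw [add_right_comm x a b]
  ring

end Moments

section Septic

variable {F : Type*} [Field F] [Fintype F] [Algebra (ZMod 2) F]

/-- The polynomial function `α x ^ 7 + ∑ i ∈ [1, s], b i * x ^ (2 ^ i + 1)`. -/
def septic (α : F) (b : ℕ → F) (s : ℕ) (x : F) : F :=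
  α * x ^ 7 + ∑ i ∈ Finset.Icc 1 s, b i * x ^ (2 ^ i + 1)

theorem sgn_second_difference (α : F) (b : ℕ → F) (s : ℕ) (u v x : F) :
    sgn (septic α b s x + septic α b s (x + u) + septic α b s (x + v) + septic α b s (x + u + v)) =
      sgn (septic α b s u + septic α b s v + septic α b s (u + v)) *
        sgn ((α * (u * v * (u + v)) + α ^ 2 * (u * v * (u + v)) ^ 2 * (u ^ 2 + u * v + v ^ 2) ^ 2 +
          α ^ 4 * (u * v * (u + v)) ^ 8) * x ^ 4) := by
  have hchar := charP_two F
  have h2 : (2 : F) = 0 := CharTwo.two_eq_zero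
  have hquad : ∀ i, x ^ (2 ^ i + 1) + (x + u) ^ (2 ^ i + 1) + (x + v) ^ (2 ^ i + 1) +
      (x + u + v) ^ (2 ^ i + 1) = u ^ (2 ^ i + 1) + v ^ (2 ^ i + 1) + (u + v) ^ (2 ^ i + 1) := by
    intro i
    simp only [pow_succ, add_pow_char_pow]
    linear_combination (2 * x ^ 2 ^ i * x + x ^ 2 ^ i * (u + v) + x * (u ^ 2 ^ i + v ^ 2 ^ i)) * h2
  have hseptic : x ^ 7 + (x + u) ^ 7 + (x + v) ^ 7 + (x + u + v) ^ 7 =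
      u ^ 7 + v ^ 7 + (u + v) ^ 7 + (u * v * (u + v) * x ^ 4 +
        u * v * (u + v) * (u ^ 2 + u * v + v ^ 2) * x ^ 2 + (u * v * (u + v)) ^ 2 * x) := by
    grind
  have hsum : septic α b s x + septic α b s (x + u) + septic α b s (x + v) +
      septic α b s (x + u + v) = septic α b s u + septic α b s v + septic α b s (u + v) +
      (α * (u * v * (u + v)) * x ^ 4 + α * (u * v * (u + v)) * (u ^ 2 + u * v + v ^ 2) * x ^ 2 +
        α * (u * v * (u + v)) ^ 2 * x) := by
    have hq : ∑ i ∈ Finset.Icc 1 s, b i * x ^ (2 ^ i + 1) +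
        ∑ i ∈ Finset.Icc 1 s, b i * (x + u) ^ (2 ^ i + 1) +
        ∑ i ∈ Finset.Icc 1 s, b i * (x + v) ^ (2 ^ i + 1) +
        ∑ i ∈ Finset.Icc 1 s, b i * (x + u + v) ^ (2 ^ i + 1) =
        ∑ i ∈ Finset.Icc 1 s, b i * u ^ (2 ^ i + 1) +
        ∑ i ∈ Finset.Icc 1 s, b i * v ^ (2 ^ i + 1) +
        ∑ i ∈ Finset.Icc 1 s, b i * (u + v) ^ (2 ^ i + 1) := by
      simp only [← Finset.sum_add_distrib, ← mul_add, hquad]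
    simp only [septic]
    linear_combination hq + α * hseptic
  rw [hsum, sgn_add]
  congr 1
  rw [sgn_add, sgn_add]
  rw [← sgn_sq (α * (u * v * (u + v)) * (u ^ 2 + u * v + v ^ 2) * x ^ 2),
    ← sgn_pow_two_pow (α * (u * v * (u + v)) ^ 2 * x) 2, ← sgn_add, ← sgn_add]
  congr 1
  ring

theorem mul_prod_sq_add_eq {F : Type*} [Field F] [CharP F 2] (α u v : F) :
    α * ((u ^ 2 + α * (u * v * (u + v)) ^ 3) * (v ^ 2 + α * (u * v * (u + v)) ^ 3) *
      ((u + v) ^ 2 + α * (u * v * (u + v)) ^ 3)) =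
    u * v * (u + v) * (α * (u * v * (u + v)) +
      α ^ 2 * (u * v * (u + v)) ^ 2 * (u ^ 2 + u * v + v ^ 2) ^ 2 +
        α ^ 4 * (u * v * (u + v)) ^ 8) := by
  have hsum : u ^ 2 + v ^ 2 + (u + v) ^ 2 = 0 := by grind
  have hpair : u ^ 2 * v ^ 2 + u ^ 2 * (u + v) ^ 2 + v ^ 2 * (u + v) ^ 2 =
      (u ^ 2 + u * v + v ^ 2) ^ 2 := by grind
  generalize hM : u * v * (u + v) = M
  have hprod : u ^ 2 * v ^ 2 * (u + v) ^ 2 = M ^ 2 := by rw [← hM]; ring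
  generalize (u + v) ^ 2 = C at *
  linear_combination α * (hprod + α * M ^ 3 * hpair + (α * M ^ 3) ^ 2 * hsum)

theorem ite_or_eq_add {P Q R : Prop} [Decidable P] [Decidable Q] [Decidable R]
    (hPQ : ¬ (P ∧ Q)) (hPR : ¬ (P ∧ R)) (hQR : ¬ (Q ∧ R)) :
    (if (P ∨ Q) ∨ R then (1 : ℤ) else 0) =
      (if P then 1 else 0) + (if Q then 1 else 0) + (if R then 1 else 0) := by
  by_cases hP : P <;> by_cases hQ : Q <;> by_cases hR : R <;> simp_all

theorem indicator_kernel {α : F} (hα : α ≠ 0) (u v : F) :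
    (if α * (u * v * (u + v)) + α ^ 2 * (u * v * (u + v)) ^ 2 * (u ^ 2 + u * v + v ^ 2) ^ 2 +
        α ^ 4 * (u * v * (u + v)) ^ 8 = 0 then (1 : ℤ) else 0) =
      (if u * v * (u + v) = 0 then 1 else 0) +
      (if u * v * (u + v) ≠ 0 ∧ u ^ 2 = α * (u * v * (u + v)) ^ 3 then 1 else 0) +
      (if u * v * (u + v) ≠ 0 ∧ v ^ 2 = α * (u * v * (u + v)) ^ 3 then 1 else 0) +
      (if u * v * (u + v) ≠ 0 ∧ (u + v) ^ 2 = α * (u * v * (u + v)) ^ 3 then 1 else 0) := by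
  have hchar := charP_two F
  by_cases hM : u * v * (u + v) = 0
  · simp [hM]
  have hprod := mul_prod_sq_add_eq α u v
  set M := u * v * (u + v) with hMdef
  have hiff : α * M + α ^ 2 * M ^ 2 * (u ^ 2 + u * v + v ^ 2) ^ 2 + α ^ 4 * M ^ 8 = 0 ↔
      (u ^ 2 = α * M ^ 3 ∨ v ^ 2 = α * M ^ 3) ∨ (u + v) ^ 2 = α * M ^ 3 := by
    have hmul : ∀ y : F, y = 0 ↔ M * y = 0 := fun y => by simp [hM]
    rw [hmul, ← hprod]
    simp only [mul_eq_zero, hα, false_or, CharTwo.add_eq_zero]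
  have hv : v ≠ 0 := fun h => hM (by simp [hMdef, h])
  have hu : u ≠ 0 := fun h => hM (by simp [hMdef, h])
  have hsq : ∀ x y : F, x ^ 2 = y ^ 2 → x = y := fun x y hxy =>
    (bijective_pow_two_pow (F := F) 1).1 (by simpa using hxy)
  have huv : ¬ (u ^ 2 = α * M ^ 3 ∧ v ^ 2 = α * M ^ 3) := fun h => by
    have := hsq u v (h.1.trans h.2.symm)
    exact hM (by rw [hMdef, this, CharTwo.add_self_eq_zero, mul_zero])
  have huc : ¬ (u ^ 2 = α * M ^ 3 ∧ (u + v) ^ 2 = α * M ^ 3) := fun h =>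
    hv (by simpa using hsq u (u + v) (h.1.trans h.2.symm))
  have hvc : ¬ (v ^ 2 = α * M ^ 3 ∧ (u + v) ^ 2 = α * M ^ 3) := fun h =>
    hu (by simpa using hsq v (u + v) (h.1.trans h.2.symm))
  rw [if_congr hiff rfl rfl, if_neg hM, zero_add, ite_or_eq_add huv huc hvc]
  simp only [ne_eq, hM, not_false_eq_true, true_and]

theorem sum_degenerate (σ : F → F → ℤ) (h1 : ∀ u, σ u 0 = 1) (h2 : ∀ v, σ 0 v = 1)
    (h3 : ∀ u, σ u u = 1) :
    ∑ u : F, ∑ v : F, (if u * v * (u + v) = 0 then 1 else 0) * σ u v =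
      3 * (Fintype.card F : ℤ) - 2 := by
  have hchar := charP_two F
  have hu : ∀ u : F, u ∈ univ.erase (0 : F) →
      ∑ v : F, (if u * v * (u + v) = 0 then 1 else 0) * σ u v = 2 := by
    intro u hu
    have hu0 : u ≠ 0 := by simpa using hu
    have : ∀ v, (if u * v * (u + v) = 0 then 1 else 0) * σ u v =
        if v = 0 ∨ v = u then 1 else 0 := by
      intro v
      have hiff : u * v * (u + v) = 0 ↔ v = 0 ∨ v = u := by
        simp [hu0, CharTwo.add_eq_zero, eq_comm]
      simp only [hiff]
      split_ifs with h
      · rcases h with rfl | rfl <;> simp [h1, h3]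
      · simp
    simp_rw [this]
    rw [← Finset.sum_filter, show (univ.filter fun v : F => v = 0 ∨ v = u) = {0, u} by ext; simp,
      Finset.sum_pair hu0.symm]
    rfl
  rw [← Finset.add_sum_erase _ _ (Finset.mem_univ (0 : F)), Finset.sum_congr rfl hu]
  have hq : 1 ≤ Fintype.card F := Fintype.card_pos
  simp [h2, Finset.card_erase_of_mem, Nat.cast_sub hq]
  ring

theorem sum_kernel {α : F} (hα : α ≠ 0) (σ : F → F → ℤ) (h1 : ∀ u, σ u 0 = 1)
    (hswap : ∀ u v, σ u v = σ v u) (hadd : ∀ u v, σ (u + v) v = σ u v) :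
    ∑ u : F, ∑ v : F,
      (if α * (u * v * (u + v)) + α ^ 2 * (u * v * (u + v)) ^ 2 * (u ^ 2 + u * v + v ^ 2) ^ 2 +
        α ^ 4 * (u * v * (u + v)) ^ 8 = 0 then (1 : ℤ) else 0) * σ u v =
      3 * (Fintype.card F : ℤ) - 2 + 3 * ∑ u : F, ∑ v : F,
        (if u * v * (u + v) ≠ 0 ∧ u ^ 2 = α * (u * v * (u + v)) ^ 3 then 1 else 0) * σ u v := by
  have hchar := charP_two F
  have h2 : ∀ v, σ 0 v = 1 := fun v => by rw [hswap, h1]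
  have h3 : ∀ u, σ u u = 1 := fun u => by rw [← hadd, CharTwo.add_self_eq_zero, h2]
  simp_rw [indicator_kernel hα, add_mul, Finset.sum_add_distrib]
  rw [sum_degenerate σ h1 h2 h3]
  have hb : ∑ u : F, ∑ v : F,
      (if u * v * (u + v) ≠ 0 ∧ v ^ 2 = α * (u * v * (u + v)) ^ 3 then (1 : ℤ) else 0) * σ u v =
      ∑ u : F, ∑ v : F,
      (if u * v * (u + v) ≠ 0 ∧ u ^ 2 = α * (u * v * (u + v)) ^ 3 then 1 else 0) * σ u v := by
    rw [Finset.sum_comm]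
    refine Finset.sum_congr rfl fun u _ => Finset.sum_congr rfl fun v _ => ?_
    rw [hswap, mul_comm v u, add_comm v u]
  have hc : ∑ u : F, ∑ v : F,
      (if u * v * (u + v) ≠ 0 ∧ (u + v) ^ 2 = α * (u * v * (u + v)) ^ 3 then (1 : ℤ) else 0) *
        σ u v =
      ∑ u : F, ∑ v : F,
      (if u * v * (u + v) ≠ 0 ∧ u ^ 2 = α * (u * v * (u + v)) ^ 3 then 1 else 0) * σ u v := by
    rw [Finset.sum_comm, Finset.sum_comm (s := univ) (t := univ) (f := fun u v => (if
      u * v * (u + v) ≠ 0 ∧ u ^ 2 = α * (u * v * (u + v)) ^ 3 then (1 : ℤ) else 0) * σ u v)]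
    refine Finset.sum_congr rfl fun v _ => ?_
    rw [← Equiv.sum_comp (Equiv.addRight v)]
    refine Finset.sum_congr rfl fun u _ => ?_
    simp only [Equiv.coe_addRight]
    have hM : (u + v) * v * u = u * v * (u + v) := by ring
    rw [hadd]
    simp only [CharTwo.add_cancel_right, hM]
  rw [hb, hc]
  ring

end Septic

section FourthMoment

variable {F : Type*} [Field F] [Fintype F] [Algebra (ZMod 2) F]

theorem sum_walshSum_septic_pow_four {α : F} (hα : α ≠ 0) (b : ℕ → F) (s : ℕ) :
    ∑ v, walshSum (septic α b s) v ^ 4 = (Fintype.card F : ℤ) ^ 2 *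
      (3 * (Fintype.card F : ℤ) - 2 + 3 * ∑ u : F, ∑ v : F,
        (if u * v * (u + v) ≠ 0 ∧ u ^ 2 = α * (u * v * (u + v)) ^ 3 then 1 else 0) *
          sgn (septic α b s u + septic α b s v + septic α b s (u + v))) := by
  have hchar := charP_two F
  have h0 : septic α b s 0 = 0 := by simp [septic]
  rw [← sum_kernel hα (fun u v => sgn (septic α b s u + septic α b s v + septic α b s (u + v)))
    (fun u => by simp [h0, CharTwo.add_self_eq_zero, sgn_zero])
    (fun u v => by rw [add_comm v u, add_comm (septic α b s v)])
    (fun u v => by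
      rw [CharTwo.add_cancel_right]
      congr 1
      ring),
    sum_walshSum_pow_four, pow_two, mul_assoc]
  congr 1
  rw [Finset.mul_sum]
  refine Finset.sum_congr rfl fun u _ => ?_
  rw [Finset.mul_sum]
  refine Finset.sum_congr rfl fun v _ => ?_
  simp_rw [sgn_second_difference]
  rw [← Finset.mul_sum]
  have h4 := (bijective_pow_two_pow (F := F) 2).sum_comp fun z => sgn ((α * (u * v * (u + v)) +
    α ^ 2 * (u * v * (u + v)) ^ 2 * (u ^ 2 + u * v + v ^ 2) ^ 2 +
      α ^ 4 * (u * v * (u + v)) ^ 8) * z)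
  norm_num at h4
  rw [h4, sum_sgn_mul]
  split_ifs <;> ring

/-- The rational function whose trace governs the fourth moment. -/
noncomputable def tailFun (β : F) (b : ℕ → F) (s : ℕ) (x : F) : F :=
  ∑ i ∈ Finset.Icc 1 s, ∑ j ∈ Finset.range i, b i * x ^ (3 * (2 ^ i + 1)) * (β / x ^ 7) ^ 2 ^ j

theorem pow_two_pow_add_self {F : Type*} [Field F] [CharP F 2] (w : F) (i : ℕ) :
    w ^ 2 ^ i + w = ∑ j ∈ Finset.range i, (w ^ 2 + w) ^ 2 ^ j := by
  induction i with
  | zero => simp [CharTwo.add_self_eq_zero]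
  | succ i ih =>
    rw [Finset.sum_range_succ, ← ih, add_pow_char_pow, ← pow_mul, pow_succ, mul_comm 2]
    linear_combination -(CharTwo.add_self_eq_zero (w ^ 2 ^ i))

theorem sgn_septic_of_artinSchreier {m : ℕ} (hF : Fintype.card F = 2 ^ m) (hm : Odd m)
    {α β x w : F} (hβ : α * β ^ 3 = 1) (hx : x ≠ 0) (hw : w ^ 2 + w = β / x ^ 7)
    (b : ℕ → F) (s : ℕ) :
    sgn (septic α b s (x ^ 3) + septic α b s (x ^ 3 * w) + septic α b s (x ^ 3 + x ^ 3 * w)) =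
      -sgn (x ^ 7 / β + tailFun β b s x) := by
  have hchar := charP_two F
  have hβ0 : β ≠ 0 := by
    rintro rfl
    simp at hβ
  have hquad : ∀ i, (x ^ 3) ^ (2 ^ i + 1) + (x ^ 3 * w) ^ (2 ^ i + 1) +
      (x ^ 3 + x ^ 3 * w) ^ (2 ^ i + 1) = x ^ (3 * (2 ^ i + 1)) * (w ^ 2 ^ i + w) := by
    intro i
    have h2 : (2 : F) = 0 := CharTwo.two_eq_zero
    rw [pow_mul x 3, pow_succ (x ^ 3 + x ^ 3 * w), add_pow_char_pow]
    simp only [pow_succ _ (2 ^ i), mul_pow]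
    linear_combination ((x ^ 3) ^ 2 ^ i * x ^ 3 * (1 + w ^ 2 ^ i * w)) * h2
  have hsept : α * (x ^ 3) ^ 7 + α * (x ^ 3 * w) ^ 7 + α * (x ^ 3 + x ^ 3 * w) ^ 7 =
      1 + (x ^ 7 / β) ^ 2 := by
    have h1 : (x ^ 3) ^ 7 + (x ^ 3 * w) ^ 7 + (x ^ 3 + x ^ 3 * w) ^ 7 =
        x ^ 21 * ((w ^ 2 + w) * (1 + (w ^ 2 + w)) ^ 2) := by
      grind
    have h2 : (1 + β / x ^ 7) ^ 2 = 1 + (β / x ^ 7) ^ 2 := by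
      rw [CharTwo.add_sq, one_pow]
    rw [← mul_add, ← mul_add, h1, hw, h2]
    field_simp
    linear_combination (x ^ 14 + β ^ 2) * hβ
  have hsum : septic α b s (x ^ 3) + septic α b s (x ^ 3 * w) +
      septic α b s (x ^ 3 + x ^ 3 * w) = 1 + (x ^ 7 / β) ^ 2 + tailFun β b s x := by
    have hq : tailFun β b s x = ∑ i ∈ Finset.Icc 1 s, b i * (x ^ 3) ^ (2 ^ i + 1) +
        ∑ i ∈ Finset.Icc 1 s, b i * (x ^ 3 * w) ^ (2 ^ i + 1) +
        ∑ i ∈ Finset.Icc 1 s, b i * (x ^ 3 + x ^ 3 * w) ^ (2 ^ i + 1) := by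
      simp only [← Finset.sum_add_distrib, ← mul_add, hquad, pow_two_pow_add_self, hw,
        Finset.mul_sum, tailFun, mul_assoc]
    rw [hq, ← hsept]
    simp only [septic]
    ring
  rw [hsum, sgn_add, sgn_add, sgn_one hF hm, sgn_sq, sgn_add]
  ring

theorem sum_kernel_eq {m : ℕ} (hF : Fintype.card F = 2 ^ m) (hm : Odd m)
    {α β : F} (hβ : α * β ^ 3 = 1) (b : ℕ → F) (s : ℕ) :
    ∑ u : F, ∑ v : F,
      (if u * v * (u + v) ≠ 0 ∧ u ^ 2 = α * (u * v * (u + v)) ^ 3 then 1 else 0) *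
        sgn (septic α b s u + septic α b s v + septic α b s (u + v)) =
      -(∑ x ∈ univ.erase (0 : F), sgn (x ^ 7 / β + tailFun β b s x) +
        ∑ x ∈ univ.erase (0 : F), sgn (x ^ 7 / β + (β / x ^ 7 + tailFun β b s x))) := by
  have hβ0 : β ≠ 0 := by
    rintro rfl
    simp at hβ
  have hα0 : α ≠ 0 := left_ne_zero_of_mul_eq_one hβ
  have hcube := bijective_pow_three hF hm
  rw [← hcube.sum_comp, ← Finset.add_sum_erase _ _ (Finset.mem_univ (0 : F))]
  simp only [ne_eq, OfNat.ofNat_ne_zero, not_false_eq_true, zero_pow, zero_mul, not_true_eq_false,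
    false_and, if_false, Finset.sum_const_zero, zero_add]
  rw [← Finset.sum_add_distrib, ← Finset.sum_neg_distrib]
  refine Finset.sum_congr rfl fun x hx => ?_
  have hx0 : x ≠ 0 := by simpa using hx
  rw [← (mulLeft_bijective₀ (x ^ 3) (pow_ne_zero 3 hx0)).sum_comp]
  have hcond : ∀ w : F, (¬ x ^ 3 * (x ^ 3 * w) * (x ^ 3 + x ^ 3 * w) = 0 ∧
      (x ^ 3) ^ 2 = α * (x ^ 3 * (x ^ 3 * w) * (x ^ 3 + x ^ 3 * w)) ^ 3) ↔
      w ^ 2 + w = β / x ^ 7 := by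
    intro w
    have hM : x ^ 3 * (x ^ 3 * w) * (x ^ 3 + x ^ 3 * w) = x ^ 9 * (w ^ 2 + w) := by ring
    rw [hM]
    have hcond3 : (x ^ 3) ^ 2 = α * (x ^ 9 * (w ^ 2 + w)) ^ 3 ↔ w ^ 2 + w = β / x ^ 7 := by
      have hcub : ((w ^ 2 + w) * x ^ 7) ^ 3 = β ^ 3 ↔ (w ^ 2 + w) * x ^ 7 = β := hcube.1.eq_iff
      rw [eq_div_iff (pow_ne_zero 7 hx0), ← hcub]
      constructor
      · intro h
        have h6 : x ^ 6 ≠ 0 := pow_ne_zero 6 hx0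
        apply mul_left_cancel₀ (mul_ne_zero hα0 h6)
        linear_combination -h - x ^ 6 * hβ
      · intro h
        linear_combination -x ^ 6 * α * h - x ^ 6 * hβ
    rw [hcond3]
    refine ⟨And.right, fun h => ⟨?_, h⟩⟩
    rw [h]
    exact mul_ne_zero (pow_ne_zero 9 hx0) (div_ne_zero hβ0 (pow_ne_zero 7 hx0))
  simp only [hcond, ite_mul, one_mul, zero_mul]
  rw [← Finset.sum_filter, Finset.sum_congr rfl (g := fun _ => -sgn (x ^ 7 / β + tailFun β b s x)),
    Finset.sum_const, nsmul_eq_mul, card_artinSchreier]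
  · rw [add_left_comm, sgn_add (β / x ^ 7)]
    ring
  · intro w hw
    exact sgn_septic_of_artinSchreier hF hm hβ hx0 (by simpa using hw) b s

end FourthMoment

section Representation

open Polynomial

variable {F : Type*} [Field F] [Algebra (ZMod 2) F]

/-- `h` agrees, up to the additive character, with a Laurent polynomial with pole order at most `e`,
odd exponents less than or equal to `B`, and no term of degree seven. -/
def IsOddLaurent (e B : ℕ) (h : F → F) : Prop :=
  ∃ p : F[X], (∀ n ∈ p.support, Odd (n + e) ∧ n ≤ B + e) ∧ p.coeff (7 + e) = 0 ∧
    ∀ x, x ≠ 0 → sgn (h x) = sgn (p.eval x / x ^ e)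

theorem IsOddLaurent.zero (e B : ℕ) : IsOddLaurent e B (fun _ : F => 0) :=
  ⟨0, by simp, by simp, by simp⟩

theorem IsOddLaurent.add {e B : ℕ} {g h : F → F} (hg : IsOddLaurent e B g)
    (hh : IsOddLaurent e B h) : IsOddLaurent e B fun x => g x + h x := by
  obtain ⟨p, hp, hp7, hpe⟩ := hg
  obtain ⟨r, hr, hr7, hre⟩ := hh
  refine ⟨p + r, fun n hn => ?_, by simp [hp7, hr7], fun x hx => ?_⟩
  · rcases Finset.mem_union.1 (support_add hn) with h | h
    exacts [hp n h, hr n h]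
  · rw [sgn_add, hpe x hx, hre x hx, eval_add, add_div, sgn_add]

theorem IsOddLaurent.sum {ι : Type*} {e B : ℕ} (s : Finset ι) (g : ι → F → F)
    (hg : ∀ i ∈ s, IsOddLaurent e B (g i)) : IsOddLaurent e B fun x => ∑ i ∈ s, g i x := by
  induction s using Finset.induction_on with
  | empty => simpa using IsOddLaurent.zero e B
  | insert a s ha ih =>
    simp only [Finset.sum_insert ha]
    exact (hg a (by simp)).add (ih fun i hi => hg i (by simp [hi]))

theorem isOddLaurent_of_monomial {e B n : ℕ} (c : F) {h : F → F} (hn : Odd (n + e))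
    (hnB : n ≤ B + e) (hn7 : n ≠ 7 + e) (hh : ∀ x, x ≠ 0 → sgn (h x) = sgn (c * x ^ n / x ^ e)) :
    IsOddLaurent e B h := by
  refine ⟨monomial n c, fun k hk => ?_, by simp [coeff_monomial, hn7], fun x hx => ?_⟩
  · obtain rfl : k = n := by simpa using support_monomial_subset n c hk
    exact ⟨hn, hnB⟩
  · simp [hh x hx]

theorem isOddLaurent_inv (β : F) (s : ℕ) :
    IsOddLaurent (2 ^ s + 6) (3 * 2 ^ s + 4) fun x : F => β / x ^ 7 := by
  have hs : 1 ≤ 2 ^ s := Nat.one_le_two_pow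
  refine isOddLaurent_of_monomial (n := 2 ^ s + 6 - 7) β ⟨2 ^ s - 1 + 3, by omega⟩ (by omega)
    (by omega) fun x hx => ?_
  have hn : 2 ^ s + 6 - 7 + 7 = 2 ^ s + 6 := by omega
  have hpow : x ^ (2 ^ s + 6 - 7) * x ^ 7 = x ^ (2 ^ s + 6) := by rw [← pow_add, hn]
  rw [← hpow]
  congr 1
  field_simp

variable [Fintype F]

theorem isOddLaurent_tail_term {s i j : ℕ} (hi : i ≤ s) (hj : j < i) (c β : F) :
    IsOddLaurent (2 ^ s + 6) (3 * 2 ^ s + 4)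
      fun x : F => c * x ^ (3 * (2 ^ i + 1)) * (β / x ^ 7) ^ 2 ^ j := by
  have hs : 2 ^ i ≤ 2 ^ s := Nat.pow_le_pow_right two_pos hi
  have hse : Even (2 ^ s) := (Nat.even_pow.2 ⟨even_two, by omega⟩)
  obtain ⟨t, ht⟩ := hse
  rcases Nat.eq_zero_or_pos j with rfl | hj0
  · have hroot : ∀ k : ℕ, ∃ y : F, y ^ 2 ^ k = c * β := fun k =>
      (bijective_pow_two_pow k).2 (c * β)
    have hlow : ∀ k n : ℕ, 2 ^ k * n + 7 = 3 * (2 ^ i + 1) → Odd n → n ≠ 7 →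
        IsOddLaurent (2 ^ s + 6) (3 * 2 ^ s + 4)
          fun x : F => c * x ^ (3 * (2 ^ i + 1)) * (β / x ^ 7) ^ 2 ^ 0 := by
      intro k n hkn hn hn7
      obtain ⟨y, hy⟩ := hroot k
      have hle : n ≤ 2 ^ k * n := Nat.le_mul_of_pos_left _ (by positivity)
      refine isOddLaurent_of_monomial (n := n + (2 ^ s + 6)) y ?_ (by omega) (by omega)
        fun x hx => ?_
      · obtain ⟨a, ha⟩ := hn
        exact ⟨a + (2 ^ s + 6), by omega⟩
      · rw [pow_add, ← mul_assoc, mul_div_assoc, div_self (pow_ne_zero _ hx), mul_one,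
          ← sgn_pow_two_pow (y * x ^ n) k, mul_pow, hy, ← pow_mul, mul_comm n, ← hkn]
        congr 1
        rw [pow_add, pow_zero, pow_one]
        field_simp
    rcases Nat.lt_or_ge i 3 with h3 | h3
    · interval_cases i
      · exact hlow 1 1 (by norm_num) odd_one (by norm_num)
      · exact hlow 3 1 (by norm_num) odd_one (by norm_num)
    · obtain ⟨k, rfl⟩ := Nat.exists_eq_add_of_le h3
      have hk : 0 < 2 ^ k := by positivity
      refine hlow 2 (6 * 2 ^ k - 1) ?_ ⟨3 * 2 ^ k - 1, by omega⟩ (by omega)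
      rw [pow_add]
      omega
  · obtain ⟨k, rfl⟩ : ∃ k, i = j + 1 + k := Nat.exists_eq_add_of_le hj
    have hik : 2 ^ (j + 1 + k) = 2 * (2 ^ j * 2 ^ k) := by ring
    have hle : 2 ^ j ≤ 2 ^ j * 2 ^ k := Nat.le_mul_of_pos_right _ (by positivity)
    have hj2 : ∃ a, 2 ^ j = 2 * a := by
      obtain ⟨a, rfl⟩ := Nat.exists_eq_add_of_le' hj0
      exact ⟨2 ^ a, by ring⟩
    have hne : 6 * (2 ^ j * 2 ^ k) ≠ 7 * 2 ^ j + 4 := by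
      rcases Nat.lt_or_ge j 3 with h3 | h3
      · interval_cases j
        · omega
        · omega
      · obtain ⟨a, rfl⟩ := Nat.exists_eq_add_of_le h3
        rw [pow_add, mul_assoc]
        omega
    rw [hik] at hs
    refine isOddLaurent_of_monomial (n := 3 * 2 ^ (j + 1 + k) + 3 + (2 ^ s + 6) - 7 * 2 ^ j)
      (c * β ^ 2 ^ j) ?_ ?_ ?_ fun x hx => ?_
    · rw [Nat.odd_iff]
      obtain ⟨a, ha⟩ := hj2
      omega
    · omega
    · omega
    · congr 1
      have hn : 3 * 2 ^ (j + 1 + k) + 3 + (2 ^ s + 6) - 7 * 2 ^ j + 7 * 2 ^ j =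
          3 * (2 ^ (j + 1 + k) + 1) + (2 ^ s + 6) := by omega
      have hpow : x ^ (3 * 2 ^ (j + 1 + k) + 3 + (2 ^ s + 6) - 7 * 2 ^ j) * x ^ (7 * 2 ^ j) =
          x ^ (3 * (2 ^ (j + 1 + k) + 1)) * x ^ (2 ^ s + 6) := by
        rw [← pow_add, hn, pow_add]
      rw [div_pow, ← pow_mul]
      rw [mul_div_assoc', div_eq_div_iff (pow_ne_zero _ hx) (pow_ne_zero _ hx)]
      linear_combination -c * β ^ 2 ^ j * hpow

theorem isOddLaurent_tailFun (β : F) (b : ℕ → F) (s : ℕ) :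
    IsOddLaurent (2 ^ s + 6) (3 * 2 ^ s + 4) (tailFun β b s) :=
  IsOddLaurent.sum _ _ fun _ hi => IsOddLaurent.sum _ _ fun _ hj =>
    isOddLaurent_tail_term (Finset.mem_Icc.1 hi).2 (Finset.mem_range.1 hj) _ _

theorem sum_sgn_le {l s : ℕ} (hF : Fintype.card F = 2 ^ (2 * l + 3)) (hls : 6 + s ≤ l) {β : F}
    (hβ : β ≠ 0) {h : F → F} (hh : IsOddLaurent (2 ^ s + 6) (3 * 2 ^ s + 4) h) :
    ∑ x ∈ univ.erase (0 : F), sgn (x ^ 7 / β + h x) ≤ 42 * 2 ^ s * 2 ^ (l + 1) - 1 := by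
  obtain ⟨p, hp, hp7, hpe⟩ := hh
  set e := 2 ^ s + 6 with he
  set P : F[X] := monomial (7 + e) β⁻¹ + p with hP
  have hs1 : 1 ≤ 2 ^ s := Nat.one_le_two_pow
  have hsupp : ∀ n ∈ P.support, Odd (n + e) ∧ n ≤ 3 * 2 ^ s + 4 + e := by
    intro n hn
    rcases Finset.mem_union.1 (support_add hn) with h | h
    · obtain rfl : n = 7 + e := by simpa using support_monomial_subset _ _ h
      exact ⟨⟨3 + e, by omega⟩, by omega⟩
    · exact hp n h
  have hcoeff : P.coeff (7 + e) = β⁻¹ := by simp [hP, hp7]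
  have hP0 : P ≠ 0 := by
    intro h
    rw [h, coeff_zero] at hcoeff
    exact inv_ne_zero hβ hcoeff.symm
  have hdeg := hsupp _ (natDegree_mem_support_of_nonzero hP0)
  have hle : 7 + e ≤ P.natDegree := le_natDegree_of_ne_zero (by rw [hcoeff]; exact inv_ne_zero hβ)
  obtain ⟨d, hd⟩ : ∃ d, P.natDegree = d + e := ⟨P.natDegree - e, by omega⟩
  have hdodd : Odd d := by
    obtain ⟨a, ha⟩ := hdeg.1
    exact ⟨a - e, by omega⟩
  have hsgn : ∀ x : F, x ≠ 0 → sgn (x ^ 7 / β + h x) = sgn (P.eval x / x ^ e) := by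
    intro x hx
    rw [sgn_add, hpe x hx, ← sgn_add, hP, eval_add, eval_monomial, add_div]
    congr 2
    rw [pow_add]
    field_simp
  have hR : 2 ^ l = 2 ^ s * 2 ^ (l - s) := by rw [← pow_add]; congr 1; omega
  have hR64 : 64 ≤ 2 ^ (l - s) :=
    (show 2 ^ 6 ≤ 2 ^ (l - s) from Nat.pow_le_pow_right two_pos (by omega))
  have hsR : 64 * 2 ^ s ≤ 2 ^ l := by rw [hR]; nlinarith
  have hdim : (2 ^ l + (2 ^ s + 3)) + 2 ^ (l + 1) * (2 ^ (l + 1) - 1) + (d + e) * 2 ^ l <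
      2 * (2 ^ l + (2 ^ s + 3)) * 2 ^ (l + 1) := by
    have hde : d + e ≤ 4 * 2 ^ s + 10 := by omega
    have hde' := Nat.mul_le_mul_right (2 ^ l) hde
    have hpos : 1 ≤ 2 ^ (l + 1) := Nat.one_le_two_pow
    zify [hpos] at *
    rw [pow_succ] at *
    nlinarith
  have key := card_filter_sgn_eq_one_le hF P hd hdodd (by positivity) hdim
  have hsum : ∑ x ∈ univ.erase (0 : F), sgn (x ^ 7 / β + h x) =
      2 * ((univ.filter fun x : F => x ≠ 0 ∧ sgn (P.eval x / x ^ e) = 1).card : ℤ) -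
        ((Fintype.card F : ℤ) - 1) := by
    have h1 : ∀ x ∈ univ.erase (0 : F), sgn (x ^ 7 / β + h x) =
        2 * (if sgn (P.eval x / x ^ e) = 1 then 1 else 0) - 1 := by
      intro x hx
      rw [hsgn x (by simpa using hx)]
      rcases sgn_eq_one_or (P.eval x / x ^ e) with h | h <;> simp [h]
    rw [Finset.sum_congr rfl h1, Finset.sum_sub_distrib, ← Finset.mul_sum, ← Finset.sum_filter,
      Finset.sum_const, Finset.sum_const, Finset.card_erase_of_mem (Finset.mem_univ _)]
    have hset : (univ.erase (0 : F)).filter (fun x => sgn (P.eval x / x ^ e) = 1) =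
        univ.filter fun x : F => x ≠ 0 ∧ sgn (P.eval x / x ^ e) = 1 := by
      ext x
      simp
    rw [hset, nsmul_one, nsmul_one, Finset.card_univ, Nat.cast_sub Fintype.card_pos, Nat.cast_one]
  rw [hsum, hF]
  have hq : (2 : ℤ) ^ (2 * l + 3) = 8 * (2 ^ l) ^ 2 := by ring
  have hde : d + e ≤ 4 * 2 ^ s + 10 := by omega
  generalize (univ.filter fun x : F => x ≠ 0 ∧ sgn (P.eval x / x ^ e) = 1).card = N at *
  have hmul := Nat.mul_le_mul_right (2 ^ (l + 1))
    (Nat.add_le_add_left hde (2 * (2 ^ l + (2 ^ s + 3))))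
  have hmul' := Nat.mul_le_mul_right (2 ^ l) hs1
  have hl : (2 : ℤ) ^ (l + 1) = 2 * 2 ^ l := by ring
  push_cast
  rw [hq, hl]
  zify at key hmul hmul'
  rw [hl] at key hmul
  nlinarith

end Representation

section LargeCoefficient

variable {F : Type*} [Field F] [Fintype F] [Algebra (ZMod 2) F]

theorem two_mul_card_pow_three_lt_sum_walshSum_septic {l s : ℕ}
    (hF : Fintype.card F = 2 ^ (2 * l + 3)) (hls : 6 + s ≤ l) {α : F} (hα : α ≠ 0) (b : ℕ → F) :
    2 * (Fintype.card F : ℤ) ^ 3 < ∑ v, walshSum (septic α b s) v ^ 4 := by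
  have hm : Odd (2 * l + 3) := ⟨l + 1, by ring⟩
  obtain ⟨β, hβ'⟩ := (bijective_pow_three hF hm).2 α⁻¹
  have hβ : α * β ^ 3 = 1 := by
    rw [show β ^ 3 = α⁻¹ from hβ', mul_inv_cancel₀ hα]
  have hβ0 : β ≠ 0 := by
    rintro rfl
    simp at hβ
  have htail := isOddLaurent_tailFun β b s
  have h1 := sum_sgn_le hF hls hβ0 htail
  have h2 := sum_sgn_le hF hls hβ0 ((isOddLaurent_inv β s).add htail)
  rw [sum_walshSum_septic_pow_four hα, sum_kernel_eq hF hm hβ]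
  have hq : (Fintype.card F : ℤ) = 8 * (2 ^ l) ^ 2 := by
    rw [hF]
    push_cast
    ring
  have hR : (64 : ℤ) * 2 ^ s ≤ 2 ^ l := by
    have : (2 : ℤ) ^ (6 + s) ≤ 2 ^ l := pow_le_pow_right₀ (by norm_num) hls
    rw [pow_add] at this
    linarith
  have hl : (2 : ℤ) ^ (l + 1) = 2 * 2 ^ l := by ring
  rw [hl] at h1 h2
  have hpos : (0 : ℤ) < 2 ^ l := by positivity
  have hmul := mul_le_mul_of_nonneg_right hR hpos.le
  rw [show 2 * (Fintype.card F : ℤ) ^ 3 = (Fintype.card F : ℤ) ^ 2 * (2 * Fintype.card F) by ring]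
  refine mul_lt_mul_of_pos_left ?_ (by rw [hq]; positivity)
  rw [hq]
  nlinarith

theorem exists_two_mul_card_lt_walshSum_sq {l s : ℕ}
    (hF : Fintype.card F = 2 ^ (2 * l + 3)) (hls : 6 + s ≤ l) {α : F} (hα : α ≠ 0) (b : ℕ → F) :
    ∃ v, 2 * (Fintype.card F : ℤ) < walshSum (septic α b s) v ^ 2 := by
  by_contra! h
  have h4 := two_mul_card_pow_three_lt_sum_walshSum_septic hF hls hα b
  have h2 := sum_walshSum_sq (septic α b s)
  have hle : ∑ v, walshSum (septic α b s) v ^ 4 ≤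
      ∑ v, 2 * (Fintype.card F : ℤ) * walshSum (septic α b s) v ^ 2 :=
    Finset.sum_le_sum fun v _ => by nlinarith [h v, sq_nonneg (walshSum (septic α b s) v)]
  rw [← Finset.mul_sum, h2] at hle
  linarith

theorem two_mul_card_filter_ne {ι : Type*} [Fintype ι] (f g : ι → ZMod 2) (c : ZMod 2) :
    2 * ((univ.filter fun x => f x ≠ g x + c).card : ℤ) =
      Fintype.card ι - (-1) ^ c.val * ∑ x, (-1 : ℤ) ^ (f x + g x).val := by
  have h : ∀ a b c : ZMod 2, (if a ≠ b + c then (2 : ℤ) else 0) =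
      1 - (-1) ^ c.val * (-1) ^ (a + b).val := by decide
  have hsum : ∑ x, (if f x ≠ g x + c then (2 : ℤ) else 0) =
      ∑ x, (1 - (-1) ^ c.val * (-1) ^ (f x + g x).val) :=
    Finset.sum_congr rfl fun x _ => h _ _ _
  rw [← Finset.sum_filter, Finset.sum_const, Finset.sum_sub_distrib, ← Finset.mul_sum] at hsum
  simp only [nsmul_eq_mul, Finset.sum_const, Finset.card_univ, mul_one] at hsum
  rw [← hsum, mul_comm]

theorem two_mul_nlF_le (m : ℕ) [Fintype (GaloisField 2 m)] (f : GaloisField 2 m → ZMod 2)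
    (v : GaloisField 2 m) :
    2 * (nlF m f : ℤ) ≤ Fintype.card (GaloisField 2 m) - |walshF m f v| := by
  have hle : ∀ c : ZMod 2, 2 * (nlF m f : ℤ) ≤
      Fintype.card (GaloisField 2 m) - (-1) ^ c.val * walshF m f v := by
    intro c
    rw [walshF, ← two_mul_card_filter_ne]
    have : nlF m f ≤ (univ.filter fun x : GaloisField 2 m =>
        f x ≠ Algebra.trace (ZMod 2) (GaloisField 2 m) (v * x) + c).card :=
      Nat.sInf_le ⟨v, c, rfl⟩
    exact_mod_cast Nat.mul_le_mul_left 2 this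
  rcases abs_choice (walshF m f v) with h | h
  · simpa [h] using hle 0
  · have := hle 1
    rw [h]
    simpa [ZMod.val_one] using this

end LargeCoefficient

theorem stmt15 (m s : ℕ) (hm : Odd m) (hms : 15 + 2 * s ≤ m)
    [Fintype (GaloisField 2 m)]
    (a7 : GaloisField 2 m) (ha7 : a7 ≠ 0) (b : ℕ → GaloisField 2 m)
    (G : GaloisField 2 m → GaloisField 2 m)
    (hG : ∀ x, G x = a7 * x ^ 7 + ∑ i ∈ Finset.Icc 1 s, b i * x ^ (2 ^ i + 1))
    (f : GaloisField 2 m → ZMod 2)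
    (hf : ∀ x, f x = Algebra.trace (ZMod 2) (GaloisField 2 m) (G x)) :
    Real.sqrt (2 * 2 ^ m) <
      ((Finset.univ.sup' Finset.univ_nonempty fun v => |walshF m f v|) : ℤ) ∧
    (nlF m f : ℝ) < 2 ^ (m - 1) - 2 ^ ((m - 1) / 2) := by
  obtain ⟨l, rfl⟩ : ∃ l, m = 2 * l + 3 := by
    obtain ⟨k, rfl⟩ := hm
    exact ⟨k - 1, by omega⟩
  have hF : Fintype.card (GaloisField 2 (2 * l + 3)) = 2 ^ (2 * l + 3) := by
    rw [← Nat.card_eq_fintype_card, GaloisField.card 2 _ (by omega)]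
  obtain ⟨v, hv⟩ := exists_two_mul_card_lt_walshSum_sq (s := s) hF (by omega) ha7 b
  have hW : walshSum (septic a7 b s) v = walshF (2 * l + 3) f v :=
    Finset.sum_congr rfl fun x _ => by rw [sgn, map_add, hf, hG, septic]
  have hpow : (2 : ℤ) * 2 ^ (2 * l + 3) = (2 ^ (l + 2)) ^ 2 := by ring
  rw [hW, hF] at hv
  push_cast at hv
  rw [hpow] at hv
  have habs : (2 : ℤ) ^ (l + 2) < |walshF (2 * l + 3) f v| :=
    lt_of_pow_lt_pow_left₀ 2 (abs_nonneg _) (by rwa [sq_abs])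
  constructor
  · have hsup : |walshF (2 * l + 3) f v| ≤
        Finset.univ.sup' Finset.univ_nonempty fun v => |walshF (2 * l + 3) f v| :=
      Finset.le_sup' (fun v => |walshF (2 * l + 3) f v|) (Finset.mem_univ v)
    have hsqrt : Real.sqrt (2 * 2 ^ (2 * l + 3)) = ((2 ^ (l + 2) : ℤ) : ℝ) := by
      rw [show (2 : ℝ) * 2 ^ (2 * l + 3) = (2 ^ (l + 2)) ^ 2 by ring,
        Real.sqrt_sq (by positivity)]
      push_cast
      rfl
    rw [hsqrt]
    exact_mod_cast habs.trans_le hsup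
  · have hnl := two_mul_nlF_le (2 * l + 3) f v
    rw [hF] at hnl
    have h1 : 2 * l + 3 - 1 = 2 * l + 2 := rfl
    have h2 : (2 * l + 3 - 1) / 2 = l + 1 := by omega
    rw [h2, h1]
    have hlt : (nlF (2 * l + 3) f : ℤ) < 2 ^ (2 * l + 2) - 2 ^ (l + 1) := by
      have h3 : (2 : ℤ) ^ (2 * l + 3) = 2 * 2 ^ (2 * l + 2) := by ring
      have h4 : (2 : ℤ) ^ (l + 2) = 2 * 2 ^ (l + 1) := by ring
      push_cast at hnl
      linarith
    exact_mod_cast hlt
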